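/- Let d be either d = pq for two primes p ≡ q ≡ 3 (mod 8), or d = p for a prime p ≡ 9 (mod 16) such that 2 is a fourth power residue modulo p. Then for every integer n ≥ 1, the Hasse unit index of L_{n,d} equals 1; that is, every unit of the ring of integers of L_{n,d} is the product of a root of unity in L_{n,d} and a unit of the ring of integers of its maximal real subfield L_{n,d}^+. -/

import Mathlib

open IntermediateField NumberField

/-- The quadratic field `ℚ(√m)` realized inside `ℂ` (for `m` of either sign). -/
noncomputable def quadField (m : ℤ) : IntermediateField ℚ ℂ :=
  IntermediateField.adjoin ℚ {z : ℂ | z ^ 2 = (m : ℂ)}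

/-- The 2-class group of a number field `K ⊆ ℂ`: the 2-primary component
(= 2-Sylow subgroup) of the ideal class group of its ring of integers. -/
noncomputable def twoClassGroup (K : IntermediateField ℚ ℂ) :
    Subgroup (ClassGroup (𝓞 K)) :=
  CommGroup.primaryComponent _ 2

/-- `h₂(m)`: the 2-class number of the quadratic field `ℚ(√m)`. -/
noncomputable def h2 (m : ℤ) : ℕ := Nat.card (twoClassGroup (quadField m))

/-- `L_{n,d} = ℚ(ζ_{2^{n+2}}, √d)`, the `n`-th layer of the cyclotomic
`ℤ₂`-extension of `ℚ(√d, √-1)`. -/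
noncomputable def Lfield (n : ℕ) (d : ℤ) : IntermediateField ℚ ℂ :=
  IntermediateField.adjoin ℚ
    ({z : ℂ | z ^ 2 ^ (n + 2) = 1} ∪ {z : ℂ | z ^ 2 = (d : ℂ)})

/-- `ℚ(ζ_{2^{n+2}} + ζ_{2^{n+2}}⁻¹, √d) = ℚ(2cos(2π/2^{n+2}), √d)`.
For `d > 0` this is the maximal real subfield `L_{n,d}⁺` of `L_{n,d}`;
for `d < 0` it is the `n`-th layer `K_{n,|d|}` of the cyclotomic
`ℤ₂`-extension of the imaginary quadratic field `ℚ(√d)`. -/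
noncomputable def LplusField (n : ℕ) (d : ℤ) : IntermediateField ℚ ℂ :=
  IntermediateField.adjoin ℚ
    ({((2 * Real.cos (2 * Real.pi / 2 ^ (n + 2)) : ℝ) : ℂ)} ∪ {z : ℂ | z ^ 2 = (d : ℂ)})

section HasseAux

open Polynomial

lemma hx_sqrt_padic (d : ℕ) (hd : d % 8 = 1) : ∃ x : ℚ_[2], x ^ 2 = (d : ℚ_[2]) := by
  have h8 : ((2 : ℕ) ^ 3 : ℤ) ∣ (1 - (d : ℤ)) := by
    norm_num
    omega
  have h1 : ‖((1 - (d : ℤ) : ℤ) : ℤ_[2])‖ ≤ ((2 : ℕ) : ℝ) ^ (-(3 : ℕ) : ℤ) :=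
    (PadicInt.norm_int_le_pow_iff_dvd).2 (by exact_mod_cast h8)
  have h2 : ‖(2 : ℤ_[2])‖ = 2⁻¹ := by
    have := PadicInt.norm_p (p := 2)
    simpa using this
  have hn : ‖(X ^ 2 - C (d : ℤ_[2]) : ℤ_[2][X]).aeval (1 : ℤ_[2])‖ <
      ‖(derivative (X ^ 2 - C (d : ℤ_[2]) : ℤ_[2][X])).aeval (1 : ℤ_[2])‖ ^ 2 := by
    simp
    push_cast at h1
    refine lt_of_le_of_lt h1 ?_
    rw [one_add_one_eq_two, h2]
    norm_num
  obtain ⟨z, hz, -⟩ := hensels_lemma hn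
  refine ⟨z, ?_⟩
  simp at hz
  have : z ^ 2 = (d : ℤ_[2]) := sub_eq_zero.1 hz
  exact_mod_cast congrArg (fun y : ℤ_[2] => (y : ℚ_[2])) this

lemma hx_irr_padic (k : ℕ) : Irreducible (cyclotomic (2 ^ (k + 1)) ℚ_[2]) := by
  have hE := cyclotomic_prime_pow_comp_X_add_one_isEisensteinAt 2 k
  have hmon : ((cyclotomic (2 ^ (k + 1)) ℤ).comp (X + 1)).Monic :=
    (cyclotomic.monic _ ℤ).comp (monic_X_add_C 1) (by
      have : (X + 1 : ℤ[X]) = X + C 1 := by simp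
      rw [this, natDegree_X_add_C]; norm_num)
  have hmap : ((cyclotomic (2 ^ (k + 1)) ℤ).comp (X + 1)).map (Int.castRingHom ℤ_[2])
      = (cyclotomic (2 ^ (k + 1)) ℤ_[2]).comp (X + 1) := by
    rw [Polynomial.map_comp]
    simp
  have hprime : (Ideal.span {(2 : ℤ_[2])}).IsPrime := by
    rw [Ideal.span_singleton_prime two_ne_zero]
    exact_mod_cast PadicInt.prime_p (p := 2)
  have hnd : ((cyclotomic (2 ^ (k + 1)) ℤ_[2]).comp (X + 1)).natDegree =
      ((cyclotomic (2 ^ (k + 1)) ℤ).comp (X + 1)).natDegree := by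
    rw [← hmap, hmon.natDegree_map]
  have hE2 : ((cyclotomic (2 ^ (k + 1)) ℤ_[2]).comp (X + 1)).IsEisensteinAt
      (Ideal.span {(2 : ℤ_[2])}) := by
    refine Monic.isEisensteinAt_of_mem_of_notMem (hmap ▸ hmon.map _) hprime.ne_top ?_ ?_
    · intro i hi
      rw [hnd] at hi
      have := hE.mem hi
      rw [← hmap, coeff_map]
      rw [Ideal.submodule_span_eq, Ideal.mem_span_singleton] at this
      rw [Ideal.mem_span_singleton]
      have h3 := map_dvd (Int.castRingHom ℤ_[2]) this
      simpa using h3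
    · have := hE.notMem
      intro hc
      apply this
      rw [← hmap, coeff_map, Ideal.span_singleton_pow, Ideal.mem_span_singleton] at hc
      rw [Ideal.submodule_span_eq, Ideal.span_singleton_pow, Ideal.mem_span_singleton]
      have h4 := (PadicInt.norm_le_pow_iff_mem_span_pow (p := 2)
        (((cyclotomic (2 ^ (k + 1)) ℤ).comp (X + 1)).coeff 0 : ℤ_[2]) 2).2 (by
          rw [Ideal.mem_span_singleton]; simpa using hc)
      exact_mod_cast (PadicInt.norm_int_le_pow_iff_dvd).1 h4
  have hirr : Irreducible ((cyclotomic (2 ^ (k + 1)) ℤ_[2]).comp (X + 1)) := by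
    refine hE2.irreducible hprime (hmap ▸ hmon.map _).isPrimitive ?_
    have : (X + 1 : ℤ_[2][X]) = X + C 1 := by simp
    rw [natDegree_comp, this, natDegree_X_add_C, natDegree_cyclotomic, mul_one]
    exact Nat.totient_pos.2 (by positivity)
  have hirr2 : Irreducible (cyclotomic (2 ^ (k + 1)) ℤ_[2]) := by
    have e := (MulEquiv.irreducible_iff (Polynomial.algEquivAevalXAddC (1 : ℤ_[2]))
      (x := cyclotomic (2 ^ (k + 1)) ℤ_[2]))
    apply e.1
    simpa [Polynomial.comp, aeval_def] using hirr
  have := ((cyclotomic.monic (2 ^ (k + 1)) ℤ_[2]).irreducible_iff_irreducible_map_fraction_map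
    (K := ℚ_[2])).1 hirr2
  simpa using this

lemma hx_irr {F : Type*} [Field F] (f : F →+* ℚ_[2]) (k : ℕ) :
    Irreducible (cyclotomic (2 ^ (k + 1)) F) := by
  refine Monic.irreducible_of_irreducible_map f _ (cyclotomic.monic _ _) ?_
  simpa using hx_irr_padic k

lemma hx_norm_le {x : ℚ_[2]} (hx : IsIntegral ℤ x) : ‖x‖ ≤ 1 := by
  have h1 : IsIntegral ℤ_[2] x := hx.tower_top
  obtain ⟨y, rfl⟩ := (IsIntegrallyClosed.isIntegral_iff (R := ℤ_[2])).1 h1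
  exact y.2

lemma hx_norm_eq {x : ℚ_[2]} (h0 : x ≠ 0) (hx : IsIntegral ℤ x) (hx' : IsIntegral ℤ x⁻¹) :
    ‖x‖ = 1 := by
  refine le_antisymm (hx_norm_le hx) ?_
  have h2 := hx_norm_le hx'
  rw [norm_inv] at h2
  exact (inv_le_one₀ (norm_pos_iff.2 h0)).1 h2

lemma hx_parity {b : ℚ_[2]} (h : ‖b ^ 2 * 2‖ = 1) : False := by
  have hb : b ≠ 0 := by rintro rfl; simp at h
  have h2 : ‖(2 : ℚ_[2])‖ = 2⁻¹ := by
    have := Padic.norm_p (p := 2)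
    simpa using this
  rw [norm_mul, norm_pow, h2, Padic.norm_eq_zpow_neg_valuation hb] at h
  have h3 : (2 : ℝ) ^ (2 * (-b.valuation) - 1) = 2 ^ (0 : ℤ) := by
    rw [zpow_sub₀ two_ne_zero, mul_comm, zpow_mul]
    simpa [div_eq_mul_inv] using h
  have := zpow_right_injective₀ (by norm_num : (0 : ℝ) < 2) (by norm_num) h3
  omega

/-- the key lemma: no unit `u` with `u = ζ * σ u`. -/
lemma hx_key {F E : Type*} [Field F] [CharZero F] [Field E] [Algebra F E] (f : F →+* ℚ_[2])
    (k : ℕ) [IsCyclotomicExtension {2 ^ (k + 2)} F E] (ζ : E)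
    (hζ : IsPrimitiveRoot ζ (2 ^ (k + 2))) (σ : E ≃ₐ[F] E) (hσ : σ ζ = ζ⁻¹)
    (hσ2 : ∀ x, σ (σ x) = x)
    (u : E) (hu0 : u ≠ 0) (hu : IsIntegral ℤ u) (hu' : IsIntegral ℤ u⁻¹) (h : u = ζ * σ u) :
    False := by
  have hfd : FiniteDimensional F E := IsCyclotomicExtension.finiteDimensional {2 ^ (k + 2)} F E
  have hζ0 : ζ ≠ 0 := hζ.ne_zero (by positivity)
  have hcz : CharZero E := charZero_of_injective_algebraMap (algebraMap F E).injective
  have hζ' : IsPrimitiveRoot (-ζ) (2 ^ (k + 2)) := by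
    have h1 : ζ ^ (2 ^ (k + 1)) = -1 := by
      have h2 : IsPrimitiveRoot (ζ ^ (2 ^ (k + 1))) 2 :=
        hζ.pow (by positivity) (by rw [← pow_succ])
      exact h2.eq_neg_one_of_two_right
    have h3 : -ζ = ζ ^ (2 ^ (k + 1) + 1) := by rw [pow_succ, h1]; ring
    rw [h3]
    apply hζ.pow_of_coprime
    apply Nat.Coprime.pow_right
    rw [pow_succ]
    simp
  have hnorm : Algebra.norm F (-ζ - 1) = 2 := hζ'.norm_sub_one_two (by omega) (hx_irr f (k + 1))
  have hne : -ζ - 1 ≠ 0 := by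
    intro h0
    rw [h0] at hnorm
    rw [Algebra.norm_zero] at hnorm
    exact two_ne_zero hnorm.symm
  set a := u / (-ζ - 1) with ha
  have hua : u = a * (-ζ - 1) := by rw [ha]; field_simp
  have hσa : σ a = a := by
    have hne' : -ζ⁻¹ - 1 ≠ 0 := by
      intro h0
      apply hne
      field_simp at h0
      linear_combination h0
    rw [ha, map_div₀, map_sub, map_neg, map_one, hσ, div_eq_div_iff hne' hne]
    field_simp
    rw [mul_comm] at h
    linear_combination ( - ζ - 1) * (-h)
  have hord : orderOf σ = 2 := by
    apply orderOf_eq_prime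
    · ext x
      simp [pow_two, hσ2]
    · rintro rfl
      simp at hσ
      have : ζ ^ 2 = 1 := by
        rw [pow_two]; nth_rw 1 [hσ]; exact inv_mul_cancel₀ hζ0
      have h5 := Nat.le_of_dvd (by norm_num) (hζ.dvd_of_pow_eq_one 2 this)
      have : 2 ^ 2 ≤ 2 ^ (k + 2) := Nat.pow_le_pow_right (by norm_num) (by omega)
      omega
  let M := IntermediateField.fixedField (Subgroup.zpowers σ)
  have hfr : Module.finrank M E = 2 := by
    rw [IntermediateField.finrank_fixedField_eq_card, Nat.card_zpowers, hord]
  have haM : a ∈ M := by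
    rw [IntermediateField.mem_fixedField_iff]
    intro g hg
    obtain ⟨m, rfl⟩ := Subgroup.mem_zpowers_iff.1 hg
    have : σ ∈ MulAction.stabilizer (E ≃ₐ[F] E) a := hσa
    exact (Subgroup.zpow_mem _ this m)
  have hna : Algebra.norm F a = (Algebra.norm F (⟨a, haM⟩ : M)) ^ 2 := by
    rw [← Algebra.norm_norm (S := M)]
    have : Algebra.norm M a = (⟨a, haM⟩ : M) ^ 2 := by
      have h7 := Algebra.norm_algebraMap (S := E) (⟨a, haM⟩ : M)
      rw [hfr] at h7
      exact h7
    rw [this, map_pow]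
  have hnu : Algebra.norm F u = (Algebra.norm F (⟨a, haM⟩ : M)) ^ 2 * 2 := by
    rw [hua, map_mul, hna, hnorm]
  have hi1 : IsIntegral ℤ (f (Algebra.norm F u)) :=
    (Algebra.isIntegral_norm F hu).map (f.toIntAlgHom)
  have hi2 : IsIntegral ℤ (f (Algebra.norm F u))⁻¹ := by
    have h8 : (Algebra.norm F u)⁻¹ = Algebra.norm F u⁻¹ := by
      symm
      apply eq_inv_of_mul_eq_one_right
      rw [← map_mul, mul_inv_cancel₀ hu0, map_one]
    rw [← map_inv₀, h8]
    exact (Algebra.isIntegral_norm F hu').map (f.toIntAlgHom)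
  have h1 := hx_norm_eq (by simpa [Algebra.norm_eq_zero_iff] using hu0) hi1 hi2
  rw [hnu, map_mul, map_pow, map_ofNat] at h1
  exact hx_parity h1

end HasseAux
section HasseAux2

open Polynomial

lemma hx_conj {z : ℂ} {N : ℕ} (hz : z ^ N = 1) (hN : N ≠ 0) : (starRingEnd ℂ) z = z⁻¹ := by
  rw [Complex.inv_def, Complex.normSq_eq_norm_sq, Complex.norm_eq_one_of_pow_eq_one hz hN]
  simp

lemma hx_emb (d : ℕ) (hd : d % 8 = 1) :
    Nonempty (IntermediateField.adjoin ℚ {Real.sqrt d} →+* ℚ_[2]) := by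
  obtain ⟨x, hx⟩ := hx_sqrt_padic d hd
  have hint : aeval (Real.sqrt d) (X ^ 2 - C (d : ℚ) : ℚ[X]) = 0 := by
    simp
  have hmon : (X ^ 2 - C (d : ℚ) : ℚ[X]).Monic := monic_X_pow_sub_C _ (by norm_num)
  have h := IntermediateField.exists_algHom_adjoin_of_splits (F := ℚ) (K := ℚ_[2])
    (S := {Real.sqrt d}) (L := ⊥) ?_ ((Algebra.ofId ℚ ℚ_[2]).comp
      (IntermediateField.botEquiv ℚ ℝ).toAlgHom) bot_le
  · obtain ⟨φ, -⟩ := h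
    exact ⟨φ.toRingHom⟩
  · intro s hs
    rw [Set.mem_singleton_iff] at hs
    subst hs
    refine ⟨⟨_, hmon, hint⟩, ?_⟩
    refine Splits.of_dvd (g := (X ^ 2 - C (d : ℚ) : ℚ[X]).map (algebraMap ℚ ℚ_[2])) ?_ ?_ ?_
    · have : (X ^ 2 - C (d : ℚ) : ℚ[X]).map (algebraMap ℚ ℚ_[2]) = (X - C x) * (X - C (-x)) := by
        simp
        have : (d : ℚ_[2][X]) = C x ^ 2 := by rw [← C_pow, hx]; simp
        rw [this]
        ring
      rw [this]
      exact (Splits.X_sub_C _).mul (Splits.X_sub_C _)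
    · exact (hmon.map _).ne_zero
    · exact Polynomial.map_dvd _ (minpoly.dvd ℚ _ hint)

lemma hx_B (d : ℕ) (hd : d % 8 = 1) (n : ℕ) :
    (∀ u ∈ Lfield n (d : ℤ), u ≠ 0 → IsIntegral ℤ u → IsIntegral ℤ u⁻¹ →
      ∀ ζ : ℂ, IsPrimitiveRoot ζ (2 ^ (n + 2)) → u ≠ ζ * (starRingEnd ℂ) u) ∧
    (∀ s, ∀ ξ ∈ Lfield n (d : ℤ), IsPrimitiveRoot ξ (2 ^ s) → s ≤ n + 2) := by
  obtain ⟨f⟩ := hx_emb d hd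
  let F := IntermediateField.adjoin ℚ {Real.sqrt d}
  change F →+* ℚ_[2] at f
  let ζ₀ : ℂ := Complex.exp (2 * Real.pi * Complex.I / ((2 ^ (n + 2) : ℕ) : ℂ))
  have hζ₀ : IsPrimitiveRoot ζ₀ (2 ^ (n + 2)) := Complex.isPrimitiveRoot_exp _ (by positivity)
  let E : IntermediateField F ℂ := IntermediateField.adjoin F {ζ₀}
  have hζE : ζ₀ ∈ E := IntermediateField.mem_adjoin_simple_self F ζ₀
  have hcyc : IsCyclotomicExtension {2 ^ (n + 2)} F E :=
    by
      have hal : IsAlgebraic F ζ₀ :=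
        ⟨X ^ (2 ^ (n + 2)) - 1, (monic_X_pow_sub_C (1 : F) (by positivity)).ne_zero, by
          simp [hζ₀.pow_eq_one]⟩
      change IsCyclotomicExtension {2 ^ (n + 2)} F (IntermediateField.adjoin F {ζ₀}).toSubalgebra
      rw [IntermediateField.adjoin_simple_toSubalgebra_of_isAlgebraic hal]
      exact hζ₀.adjoin_isCyclotomicExtension F
  have hfd : FiniteDimensional F E := IsCyclotomicExtension.finiteDimensional {2 ^ (n + 2)} F E
  have hgal : IsGalois F E := IsCyclotomicExtension.isGalois {2 ^ (n + 2)} F E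
  have hle : ∀ z ∈ Lfield n (d : ℤ), z ∈ E := by
    have : Lfield n (d : ℤ) ≤ E.restrictScalars ℚ := by
      rw [Lfield, IntermediateField.adjoin_le_iff]
      rintro z (hz | hz)
      · obtain ⟨i, -, rfl⟩ := hζ₀.eq_pow_of_pow_eq_one hz
        exact pow_mem hζE i
      · have h1 : ((Real.sqrt d : ℝ) : ℂ) ∈ E :=
          E.algebraMap_mem ⟨Real.sqrt d, IntermediateField.mem_adjoin_simple_self ℚ _⟩
        have h2 : z ^ 2 = ((Real.sqrt d : ℝ) : ℂ) ^ 2 := by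
          rw [← Complex.ofReal_pow, Real.sq_sqrt (by positivity)]
          simpa using hz
        rcases sq_eq_sq_iff_eq_or_eq_neg.1 h2 with h | h
        · rw [h]; exact h1
        · rw [h]; exact neg_mem h1
    exact this
  let σ : E ≃ₐ[F] E := (Complex.conjAe.restrictScalars F).restrictNormal E
  have hσ : ∀ x : E, ((σ x : E) : ℂ) = (starRingEnd ℂ) (x : ℂ) := fun x =>
    AlgEquiv.restrictNormal_commutes (Complex.conjAe.restrictScalars F) E x
  have hσ2 : ∀ x, σ (σ x) = x := by
    intro x
    apply Subtype.ext
    rw [hσ, hσ, Complex.conj_conj]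
  constructor
  · intro u hu hu0 hui hui' ζ hζ h
    have hζ1 : ζ ∈ E := by
      obtain ⟨i, -, rfl⟩ := hζ₀.eq_pow_of_pow_eq_one hζ.pow_eq_one
      exact pow_mem hζE i
    refine hx_key f n (E := E) ⟨ζ, hζ1⟩ ?_ σ ?_ hσ2 ⟨u, hle u hu⟩ ?_ ?_ ?_ ?_
    · exact (IsPrimitiveRoot.coe_submonoidClass_iff).1 hζ
    · apply Subtype.ext
      rw [hσ]
      exact hx_conj hζ.pow_eq_one (by positivity)
    · intro h0
      exact hu0 (congrArg Subtype.val h0)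
    · exact (isIntegral_algebraMap_iff (algebraMap E ℂ).injective).1 hui
    · exact (isIntegral_algebraMap_iff (algebraMap E ℂ).injective).1 hui'
    · apply Subtype.ext
      simp only [MulMemClass.coe_mul, hσ]
      exact h
  · intro s ξ hξ hs
    by_contra hlt
    push Not at hlt
    obtain ⟨k, rfl⟩ : ∃ k, s = k + 1 := ⟨s - 1, by omega⟩
    have hs' : IsPrimitiveRoot (⟨ξ, hle ξ hξ⟩ : E) (2 ^ (k + 1)) :=
      (IsPrimitiveRoot.coe_submonoidClass_iff).1 hs
    have h1 := hs'.minpoly_eq_cyclotomic_of_irreducible (hx_irr f k)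
    have h2 := minpoly.natDegree_le (A := F) (⟨ξ, hle ξ hξ⟩ : E)
    rw [← h1, natDegree_cyclotomic, IsCyclotomicExtension.finrank E (hx_irr f (n + 1)),
      Nat.totient_prime_pow_succ Nat.prime_two, Nat.totient_prime_pow_succ Nat.prime_two] at h2
    have : 2 ^ (n + 1) < 2 ^ k := Nat.pow_lt_pow_right (by norm_num) (by omega)
    omega

end HasseAux2
section HasseAux3

open Polynomial

lemma hx_real_sqrt {d : ℕ} {z : ℂ} (hz : z ^ 2 = ((d : ℤ) : ℂ)) : (starRingEnd ℂ) z = z := by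
  have h2 : z ^ 2 = ((Real.sqrt d : ℝ) : ℂ) ^ 2 := by
    rw [← Complex.ofReal_pow, Real.sq_sqrt (by positivity)]
    simpa using hz
  rcases sq_eq_sq_iff_eq_or_eq_neg.1 h2 with h | h
  · rw [h, Complex.conj_ofReal]
  · rw [h, map_neg, Complex.conj_ofReal]

lemma hx_gen_integral (n d : ℕ) (z : ℂ)
    (hz : z ∈ ({z : ℂ | z ^ 2 ^ (n + 2) = 1} ∪ {z : ℂ | z ^ 2 = ((d : ℤ) : ℂ)})) :
    IsIntegral ℚ z := by
  rcases hz with hz | hz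
  · exact IsIntegral.of_pow (n := 2 ^ (n + 2)) (by positivity) (by
      rw [Set.mem_ofPred_eq] at hz; rw [hz]; exact isIntegral_one)
  · exact IsIntegral.of_pow (n := 2) (by positivity) (by
      rw [Set.mem_ofPred_eq] at hz; rw [hz]
      simpa using isIntegral_algebraMap (R := ℚ) (A := ℂ) (x := ((d : ℤ) : ℚ)))

lemma hx_numberField (n d : ℕ) : NumberField (Lfield n (d : ℤ)) := by
  have hfin : ({z : ℂ | z ^ 2 ^ (n + 2) = 1} ∪ {z : ℂ | z ^ 2 = ((d : ℤ) : ℂ)}).Finite := by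
    apply Set.Finite.union
    · refine (((X ^ (2 ^ (n + 2)) - C (1 : ℂ) : ℂ[X]).roots.toFinset).finite_toSet).subset ?_
      intro z hz
      have := (monic_X_pow_sub_C (1 : ℂ) (n := 2 ^ (n + 2)) (by positivity)).ne_zero
      rw [Set.mem_ofPred_eq] at hz
      rw [Finset.mem_coe, Multiset.mem_toFinset, mem_roots this, IsRoot]
      simp [hz]
    · refine (((X ^ 2 - C ((d : ℤ) : ℂ) : ℂ[X]).roots.toFinset).finite_toSet).subset ?_
      intro z hz
      have := (monic_X_pow_sub_C ((d : ℤ) : ℂ) (n := 2) (by positivity)).ne_zero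
      rw [Set.mem_ofPred_eq] at hz
      rw [Finset.mem_coe, Multiset.mem_toFinset, mem_roots this, IsRoot]
      simp [hz]
  have := hfin.to_subtype
  have h : FiniteDimensional ℚ (Lfield n (d : ℤ)) :=
    IntermediateField.finiteDimensional_adjoin (hx_gen_integral n d)
  exact { to_charZero := inferInstance, to_finiteDimensional := h }

/-- complex conjugation over ℚ -/
noncomputable def hxConj : ℂ →ₐ[ℚ] ℂ := (Complex.conjAe.restrictScalars ℚ).toAlgHom

lemma hxConj_apply (z : ℂ) : hxConj z = (starRingEnd ℂ) z := rfl

lemma hx_conj_mem (n d : ℕ) {z : ℂ} (hz : z ∈ Lfield n (d : ℤ)) :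
    (starRingEnd ℂ) z ∈ Lfield n (d : ℤ) := by
  have h : Lfield n (d : ℤ) ≤ (Lfield n (d : ℤ)).comap hxConj := by
    conv_lhs => rw [Lfield]
    rw [IntermediateField.adjoin_le_iff]
    intro w hw
    change (starRingEnd ℂ) w ∈ Lfield n (d : ℤ)
    rcases hw with hw | hw
    · rw [hx_conj hw (by positivity)]
      exact inv_mem (IntermediateField.subset_adjoin _ _ (Or.inl hw))
    · rw [hx_real_sqrt hw]
      exact IntermediateField.subset_adjoin _ _ (Or.inr hw)
  exact h hz

lemma hx_kron (n d : ℕ) (u : ℂ) (hu : u ∈ Lfield n (d : ℤ)) (hu0 : u ≠ 0)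
    (hi : IsIntegral ℤ u) (hi' : IsIntegral ℤ u⁻¹) :
    ∃ m : ℕ, 0 < m ∧ (u / (starRingEnd ℂ) u) ^ m = 1 := by
  have hnf := hx_numberField n d
  let τ : Lfield n (d : ℤ) →ₐ[ℚ] Lfield n (d : ℤ) :=
    AlgHom.codRestrict (hxConj.comp (Lfield n (d : ℤ)).val) (Lfield n (d : ℤ)).toSubalgebra
      (fun x => hx_conj_mem n d x.2)
  have hτ : ∀ x, ((τ x : Lfield n (d : ℤ)) : ℂ) = (starRingEnd ℂ) (x : ℂ) := fun x => rfl
  let U : Lfield n (d : ℤ) := ⟨u, hu⟩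
  have hU0 : U ≠ 0 := fun h => hu0 (congrArg Subtype.val h)
  have hUi : IsIntegral ℤ U :=
    (isIntegral_algebraMap_iff (algebraMap (Lfield n (d : ℤ)) ℂ).injective).1 hi
  have hUi' : IsIntegral ℤ U⁻¹ :=
    (isIntegral_algebraMap_iff (algebraMap (Lfield n (d : ℤ)) ℂ).injective).1 hi'
  have hkey : ∀ φ : Lfield n (d : ℤ) →+* ℂ, ∀ x, φ (τ x) = (starRingEnd ℂ) (φ x) := by
    intro φ x
    have : (φ.toRatAlgHom).comp τ = hxConj.comp φ.toRatAlgHom := by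
      refine IntermediateField.algHom_ext_of_eq_adjoin ℚ (S := Lfield n (d : ℤ)) rfl ?_
      intro z hz
      change φ (τ _) = (starRingEnd ℂ) (φ _)
      have hzm : z ∈ Lfield n (d : ℤ) := IntermediateField.subset_adjoin _ _ hz
      change φ (τ ⟨z, hzm⟩) = (starRingEnd ℂ) (φ ⟨z, hzm⟩)
      rcases hz with hz | hz
      · have h1 : τ ⟨z, hzm⟩ = (⟨z, hzm⟩ : Lfield n (d : ℤ))⁻¹ := by
          apply Subtype.ext
          rw [hτ]
          exact hx_conj hz (by positivity)
        have h2 : (φ ⟨z, hzm⟩) ^ 2 ^ (n + 2) = 1 := by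
          rw [← map_pow, ← map_one φ]
          congr 1
          exact Subtype.ext hz
        rw [h1, map_inv₀, hx_conj h2 (by positivity)]
      · have h1 : τ ⟨z, hzm⟩ = (⟨z, hzm⟩ : Lfield n (d : ℤ)) := by
          apply Subtype.ext
          rw [hτ]
          exact hx_real_sqrt hz
        have h2 : (φ ⟨z, hzm⟩) ^ 2 = ((d : ℤ) : ℂ) := by
          rw [← map_pow, ← map_intCast φ]
          congr 1
          exact Subtype.ext hz
        rw [h1, hx_real_sqrt h2]
    exact DFunLike.congr_fun this x
  have hint : IsIntegral ℤ (U * τ (U⁻¹)) := hUi.mul (hUi'.map τ)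
  obtain ⟨m, hm, h⟩ := NumberField.Embeddings.pow_eq_one_of_norm_eq_one (Lfield n (d : ℤ)) ℂ hint
    (by
      intro φ
      have h0 : φ U ≠ 0 := by simpa using hU0
      rw [map_mul, hkey, map_inv₀, norm_mul, RCLike.norm_conj, norm_inv]
      exact mul_inv_cancel₀ (norm_ne_zero_iff.2 h0))
  refine ⟨m, hm, ?_⟩
  have h5 := congrArg (Subtype.val) h
  have h6 : ((U * τ (U⁻¹) : Lfield n (d : ℤ)) : ℂ) = u / (starRingEnd ℂ) u := by
    rw [MulMemClass.coe_mul, hτ, div_eq_mul_inv, ← map_inv₀]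
    rfl
  rw [← h6]
  exact h5

lemma hx_real_mem (n d : ℕ) {z : ℂ} (hz : z ∈ Lfield n (d : ℤ)) (hr : (starRingEnd ℂ) z = z) :
    z ∈ LplusField n (d : ℤ) := by
  set θ : ℝ := 2 * Real.pi / 2 ^ (n + 2) with hθ
  let ζ : ℂ := Complex.exp (2 * Real.pi * Complex.I / ((2 ^ (n + 2) : ℕ) : ℂ))
  have hζ : IsPrimitiveRoot ζ (2 ^ (n + 2)) := Complex.isPrimitiveRoot_exp _ (by positivity)
  have hζ0 : ζ ≠ 0 := Complex.exp_ne_zero _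
  have hζθ : ζ = Complex.exp (θ * Complex.I) := by
    simp only [ζ, hθ]
    congr 1
    push_cast
    ring
  have hζ1 : ζ = Real.cos θ + Real.sin θ * Complex.I := by
    rw [hζθ, Complex.exp_mul_I]
    simp
  have hsq : ζ ^ 2 = ((2 * Real.cos θ : ℝ) : ℂ) * ζ - 1 := by
    have h3 : (Real.sin θ : ℂ) ^ 2 + (Real.cos θ : ℂ) ^ 2 = 1 := by
      exact_mod_cast Real.sin_sq_add_cos_sq θ
    rw [hζ1]
    push_cast at h3 ⊢
    linear_combination (Complex.sin θ) ^ 2 * Complex.I_sq - h3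
  have hcm : ((2 * Real.cos θ : ℝ) : ℂ) ∈ LplusField n (d : ℤ) :=
    IntermediateField.subset_adjoin _ _ (Or.inl rfl)
  set M := LplusField n (d : ℤ) with hM
  have hrepr : ∀ w ∈ Algebra.adjoin ℚ
      ({z : ℂ | z ^ 2 ^ (n + 2) = 1} ∪ {z : ℂ | z ^ 2 = ((d : ℤ) : ℂ)}),
      ∃ x ∈ M, ∃ y ∈ M, w = x + y * ζ := by
    have hmul : ∀ a b : ℂ, (∃ x ∈ M, ∃ y ∈ M, a = x + y * ζ) → (∃ x ∈ M, ∃ y ∈ M, b = x + y * ζ) →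
        (∃ x ∈ M, ∃ y ∈ M, a * b = x + y * ζ) := by
      rintro a b ⟨x, hx, y, hy, rfl⟩ ⟨x', hx', y', hy', rfl⟩
      refine ⟨x * x' - y * y', sub_mem (mul_mem hx hx') (mul_mem hy hy'),
        x * y' + y * x' + y * y' * ((2 * Real.cos θ : ℝ) : ℂ),
        add_mem (add_mem (mul_mem hx hy') (mul_mem hy hx')) (mul_mem (mul_mem hy hy') hcm), ?_⟩
      linear_combination y * y' * hsq
    intro w hw
    induction hw using Algebra.adjoin_induction with
    | mem w hw =>
      rcases hw with hw | hw
      · obtain ⟨i, -, rfl⟩ := hζ.eq_pow_of_pow_eq_one hw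
        clear hw
        induction i with
        | zero => exact ⟨1, one_mem _, 0, zero_mem _, by simp⟩
        | succ i ih =>
          rw [pow_succ]
          exact hmul _ _ ih ⟨0, zero_mem _, 1, one_mem _, by simp⟩
      · exact ⟨w, IntermediateField.subset_adjoin _ _ (Or.inr hw), 0, zero_mem _, by simp⟩
    | algebraMap r => exact ⟨_, M.algebraMap_mem r, 0, zero_mem _, by simp⟩
    | add a b _ _ ha hb =>
      obtain ⟨x, hx, y, hy, rfl⟩ := ha
      obtain ⟨x', hx', y', hy', rfl⟩ := hb
      exact ⟨x + x', add_mem hx hx', y + y', add_mem hy hy', by ring⟩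
    | mul a b _ _ ha hb => exact hmul a b ha hb
  have hMreal : ∀ x ∈ M, (starRingEnd ℂ) x = x := by
    have : M ≤ (AlgHom.equalizer hxConj (AlgHom.id ℚ ℂ)).toIntermediateField (by
        intro x hx
        rw [AlgHom.mem_equalizer] at hx ⊢
        rw [map_inv₀, hx]
        rfl) := by
      rw [hM, LplusField, IntermediateField.adjoin_le_iff]
      rintro x (hx | hx)
      · rw [Set.mem_singleton_iff] at hx
        rw [hx]
        exact Complex.conj_ofReal _
      · exact hx_real_sqrt hx
    intro x hx
    exact this hx
  have hz' : z ∈ (Lfield n (d : ℤ)).toSubalgebra := hz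
  rw [Lfield, IntermediateField.adjoin_toSubalgebra_of_isAlgebraic
    (fun x hx => (hx_gen_integral n d x hx).isAlgebraic)] at hz'
  obtain ⟨x, hx, y, hy, rfl⟩ := hrepr z hz'
  have hζne : (starRingEnd ℂ) ζ ≠ ζ := by
    rw [hx_conj hζ.pow_eq_one (by positivity)]
    intro h
    have h4 : ζ ^ 2 = 1 := by
      rw [pow_two]; nth_rw 1 [← h]; exact inv_mul_cancel₀ hζ0
    have h5 := Nat.le_of_dvd (by norm_num) (hζ.dvd_of_pow_eq_one 2 h4)
    have : 2 ^ 2 ≤ 2 ^ (n + 2) := Nat.pow_le_pow_right (by norm_num) (by omega)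
    omega
  rw [map_add, map_mul, hMreal x hx, hMreal y hy] at hr
  have hy0 : y = 0 := by
    have : y * ((starRingEnd ℂ) ζ - ζ) = 0 := by linear_combination hr
    rcases mul_eq_zero.1 this with h | h
    · exact h
    · exact absurd (sub_eq_zero.1 h) hζne
  rw [hy0]
  simpa using hx

lemma hx_main (n d : ℕ) (hd : d % 8 = 1) (u : ℂ) (hu : u ∈ Lfield n (d : ℤ)) (hu0 : u ≠ 0)
    (hi : IsIntegral ℤ u) (hi' : IsIntegral ℤ u⁻¹) :
    ∃ z ∈ Lfield n (d : ℤ), ∃ k : ℕ, 0 < k ∧ z ^ k = 1 ∧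
      u / z ∈ LplusField n (d : ℤ) := by
  obtain ⟨m, hm, hξ⟩ := hx_kron n d u hu hu0 hi hi'
  set ξ := u / (starRingEnd ℂ) u with hξdef
  have hcu0 : (starRingEnd ℂ) u ≠ 0 := by simpa using hu0
  have hξL : ξ ∈ Lfield n (d : ℤ) := div_mem hu (hx_conj_mem n d hu)
  obtain ⟨hB1, hB2⟩ := hx_B d hd n
  obtain ⟨s, t, ht, rfl⟩ := Nat.exists_eq_two_pow_mul_odd hm.ne'
  obtain ⟨r, rfl⟩ := ht
  -- choose `η` with `η ^ 2 = ξ * (2-power root)`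
  have hroot : ∃ e : ℕ, e ≤ n + 2 ∧ IsPrimitiveRoot (ξ ^ (2 * r + 1)) (2 ^ e) := by
    have h1 : (ξ ^ (2 * r + 1)) ^ 2 ^ s = 1 := by rw [← pow_mul, mul_comm]; exact hξ
    obtain ⟨e, -, he⟩ := (Nat.dvd_prime_pow Nat.prime_two).1 (orderOf_dvd_of_pow_eq_one h1)
    have h2 : IsPrimitiveRoot (ξ ^ (2 * r + 1)) (2 ^ e) := he ▸ IsPrimitiveRoot.orderOf _
    exact ⟨e, hB2 e _ (pow_mem hξL _) h2, h2⟩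
  obtain ⟨e, he, hprim⟩ := hroot
  have hm0 : 2 ^ s * (2 * r + 1) ≠ 0 := hm.ne'
  have hξ0 : ξ ≠ 0 := div_ne_zero hu0 hcu0
  have hξint : ∀ j : ℕ, IsIntegral ℤ (ξ ^ j) := fun j => by
    apply IsIntegral.of_pow (n := 2 ^ s * (2 * r + 1)) (by positivity)
    rw [← pow_mul, mul_comm, pow_mul, hξ, one_pow]
    exact isIntegral_one
  have hξint' : ∀ j : ℕ, IsIntegral ℤ (ξ ^ j)⁻¹ := fun j => by
    apply IsIntegral.of_pow (n := 2 ^ s * (2 * r + 1)) (by positivity)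
    rw [inv_pow, ← pow_mul, mul_comm, pow_mul, hξ, one_pow, inv_one]
    exact isIntegral_one
  have hξconj : (starRingEnd ℂ) ξ = ξ⁻¹ := hx_conj hξ hm0
  have huξ : u = ξ * (starRingEnd ℂ) u := by rw [hξdef]; field_simp
  rcases Nat.lt_or_ge e (n + 2) with hlt | hge
  · -- the 2-part of `ξ` is a square
    let ζ : ℂ := Complex.exp (2 * Real.pi * Complex.I / ((2 ^ (n + 2) : ℕ) : ℂ))
    have hζ : IsPrimitiveRoot ζ (2 ^ (n + 2)) := Complex.isPrimitiveRoot_exp _ (by positivity)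
    have hζ0 : ζ ≠ 0 := Complex.exp_ne_zero _
    have hζL : ζ ∈ Lfield n (d : ℤ) := IntermediateField.subset_adjoin _ _ (Or.inl hζ.pow_eq_one)
    have hζ2 : IsPrimitiveRoot (ζ ^ 2) (2 ^ (n + 1)) :=
      hζ.pow (by positivity) (by rw [pow_succ, mul_comm])
    obtain ⟨i, -, hi2⟩ := hζ2.eq_pow_of_pow_eq_one (ξ := ξ ^ (2 * r + 1)) (by
      obtain ⟨c, hc⟩ := Nat.pow_dvd_pow 2 (show e ≤ n + 1 by omega)
      rw [hc, pow_mul, hprim.pow_eq_one, one_pow])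
    -- ξ = (ζ ^ i / ξ ^ r) ^ 2
    set z := ζ ^ i / ξ ^ r with hzdef
    have hz0 : z ≠ 0 := div_ne_zero (pow_ne_zero _ hζ0) (pow_ne_zero _ hξ0)
    have hz2 : z ^ 2 = ξ := by
      rw [hzdef, div_pow, div_eq_iff (pow_ne_zero _ (pow_ne_zero _ hξ0)), ← pow_mul, mul_comm i,
        pow_mul, hi2]
      ring
    have hzL : z ∈ Lfield n (d : ℤ) := div_mem (pow_mem hζL _) (pow_mem hξL _)
    have hzk : z ^ (2 * (2 ^ s * (2 * r + 1))) = 1 := by rw [pow_mul, hz2, hξ]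
    refine ⟨z, hzL, _, by positivity, hzk, hx_real_mem n d (div_mem hu hzL) ?_⟩
    rw [map_div₀, hx_conj hzk (by positivity), div_inv_eq_mul, eq_div_iff hz0]
    rw [mul_assoc, ← pow_two, hz2, mul_comm]
    exact huξ.symm
  · -- contradiction
    exfalso
    have heq : e = n + 2 := le_antisymm he hge
    subst heq
    refine hB1 (u * ξ ^ r) (mul_mem hu (pow_mem hξL _)) (mul_ne_zero hu0 (pow_ne_zero _ hξ0))
      (hi.mul (hξint r)) ?_ _ hprim ?_
    · rw [mul_inv]
      exact hi'.mul (hξint' r)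
    · rw [map_mul, map_pow, hξconj]
      nth_rw 1 [huξ]
      rw [inv_pow]
      field_simp
      ring

end HasseAux3

/-- for `d = pq` with primes `p ≡ q ≡ 3 (mod 8)`, or `d = p` a prime
`≡ 9 (mod 16)` with `2` a fourth power residue mod `p`, and any `n ≥ 1`, the Hasse
unit index of `L_{n,d}` equals 1: every unit of the ring of integers of `L_{n,d}`
is the product of a root of unity in `L_{n,d}` and a unit of the ring of integers
of its maximal real subfield `L_{n,d}⁺`. -/
theorem hasse_unit_index_Lfield_eq_one
    (d : ℕ)
    (hd : (∃ p q : ℕ, p.Prime ∧ q.Prime ∧ p % 8 = 3 ∧ q % 8 = 3 ∧ p ≠ q ∧ d = p * q) ∨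
          (d.Prime ∧ d % 16 = 9 ∧ ∃ x : ZMod d, x ^ 4 = 2))
    (n : ℕ) (hn : 1 ≤ n) :
    ∀ u : (𝓞 (Lfield n (d : ℤ)))ˣ,
      ∃ (z : ℂ) (w : (𝓞 (LplusField n (d : ℤ)))ˣ),
        z ∈ Lfield n (d : ℤ) ∧ (∃ k : ℕ, 0 < k ∧ z ^ k = 1) ∧
        (((u : 𝓞 (Lfield n (d : ℤ))) : Lfield n (d : ℤ)) : ℂ) =
          z * (((w : 𝓞 (LplusField n (d : ℤ))) : LplusField n (d : ℤ)) : ℂ) := by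
  have hd8 : d % 8 = 1 := by
    rcases hd with ⟨p, q, -, -, hp, hq, -, rfl⟩ | ⟨-, h, -⟩
    · rw [Nat.mul_mod, hp, hq]
    · omega
  intro u
  set v : ℂ := (((u : 𝓞 (Lfield n (d : ℤ))) : Lfield n (d : ℤ)) : ℂ) with hv
  set v' : ℂ := ((((u⁻¹ : (𝓞 (Lfield n (d : ℤ)))ˣ) : 𝓞 (Lfield n (d : ℤ))) :
    Lfield n (d : ℤ)) : ℂ) with hv'
  have hvv : v * v' = 1 := by
    have h1 : (u : 𝓞 (Lfield n (d : ℤ))) * ((u⁻¹ : (𝓞 (Lfield n (d : ℤ)))ˣ)) = 1 := u.mul_inv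
    have h2 := congrArg (fun x : 𝓞 (Lfield n (d : ℤ)) => ((x : Lfield n (d : ℤ)) : ℂ)) h1
    exact h2
  have hv0 : v ≠ 0 := left_ne_zero_of_mul_eq_one hvv
  have hvinv : v⁻¹ = v' := inv_eq_of_mul_eq_one_right hvv
  have hcoe : ∀ x : 𝓞 (Lfield n (d : ℤ)), IsIntegral ℤ ((x : Lfield n (d : ℤ)) : ℂ) := fun x =>
    (RingOfIntegers.isIntegral_coe x).map (algebraMap (Lfield n (d : ℤ)) ℂ).toIntAlgHom
  have hi : IsIntegral ℤ v := hcoe _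
  have hi' : IsIntegral ℤ v⁻¹ := hvinv ▸ hcoe _
  obtain ⟨z, hzL, k, hk, hzk, hw⟩ := hx_main n d hd8 v (SetLike.coe_mem _) hv0 hi hi'
  have hz0 : z ≠ 0 := by
    rintro rfl
    rw [zero_pow hk.ne'] at hzk
    exact zero_ne_one hzk
  have hzi : IsIntegral ℤ z := IsIntegral.of_pow hk (hzk ▸ isIntegral_one)
  have hzi' : IsIntegral ℤ z⁻¹ := IsIntegral.of_pow hk (by
    rw [inv_pow, hzk, inv_one]; exact isIntegral_one)
  have hinj := (algebraMap (LplusField n (d : ℤ)) ℂ).injective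
  let W : LplusField n (d : ℤ) := ⟨v / z, hw⟩
  have hW : IsIntegral ℤ W := (isIntegral_algebraMap_iff hinj).1 (by
    change IsIntegral ℤ (v / z)
    rw [div_eq_mul_inv]
    exact hi.mul hzi')
  have hW' : IsIntegral ℤ W⁻¹ := (isIntegral_algebraMap_iff hinj).1 (by
    change IsIntegral ℤ (v / z)⁻¹
    rw [inv_div, div_eq_mul_inv]
    exact hzi.mul hi')
  have hW0 : W ≠ 0 := fun h => div_ne_zero hv0 hz0 (congrArg Subtype.val h)
  let w : (𝓞 (LplusField n (d : ℤ)))ˣ :=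
    ⟨⟨W, hW⟩, ⟨W⁻¹, hW'⟩, RingOfIntegers.ext (mul_inv_cancel₀ hW0),
      RingOfIntegers.ext (inv_mul_cancel₀ hW0)⟩
  refine ⟨z, w, hzL, ⟨k, hk, hzk⟩, ?_⟩
  change v = z * (v / z)
  field_simp
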